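/- There is an absolute constant C > 0 with the following property. Let n ≥ 3, let m be an integer with 1 < m < n/2, and let p, q ∈ (0,1) satisfy (m/(2(n − 2m)))·(q + 4/n) ≥ p. Consider the MMAHH with acceptance operators OI and AM on f = Jump_m, started from x_0 uniformly distributed on {0,1}^n and s_0 = OI. Then the runtime T satisfies E[T] ≤ C·(1 + p·n)·(1/p + 1/q)·(n + n^m/((m−1)!·(1−q)^{m−2})). -/

import Mathlib

open MeasureTheory
open scoped ENNReal NNReal

namespace MMAHHStmt

/-- The two acceptance operators. -/
inductive Op : Type
  | OI : Op
  | AM : Op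
  deriving DecidableEq

instance : MeasurableSpace Op := ⊤

/-- Search points: bit-strings of length `n`. -/
abbrev Point (n : ℕ) := Fin n → Bool

/-- The number of one-bits of a bit-string. -/
def ones {n : ℕ} (x : Point n) : ℕ := (Finset.univ.filter fun i => x i = true).card

/-- The all-ones string, the global optimum of all benchmarks considered. -/
def optimum (n : ℕ) : Point n := fun _ => true

/-- Flipping the bit in position `v`. -/
def flipBit {n : ℕ} (x : Point n) (v : Fin n) : Point n := Function.update x v (!(x v))

open Classical in
/-- The search point obtained from `x` by proposing to flip bit `v` and applying the
acceptance operator `op` for the objective function `f`. -/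
noncomputable def movedPoint {n : ℕ} (f : Point n → ℝ) (op : Op) (x : Point n) (v : Fin n) :
    Point n :=
  match op with
  | Op.OI => if f x < f (flipBit x v) then flipBit x v else x
  | Op.AM => flipBit x v

open Classical in
/-- One-step transition probability of the search point under acceptance operator `op`:
a uniformly random bit is flipped and the move is accepted or rejected according to `op`. -/
noncomputable def moveProb {n : ℕ} (f : Point n → ℝ) (op : Op) (x x' : Point n) : ℝ≥0∞ :=
  ((Finset.univ.filter fun v => movedPoint f op x v = x').card : ℝ≥0∞) / n

/-- Transition probabilities of the two-state Markov chain on the acceptance operators. -/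
noncomputable def switchProb (p q : ℝ) : Op → Op → ℝ≥0∞
  | Op.OI, Op.OI => ENNReal.ofReal (1 - p)
  | Op.OI, Op.AM => ENNReal.ofReal p
  | Op.AM, Op.OI => ENNReal.ofReal q
  | Op.AM, Op.AM => ENNReal.ofReal (1 - q)

/-- One-step transition probabilities of the MMAHH on the state space
`Point n × Op`: the search point moves according to the current acceptance operator, and,
independently, the operator switches according to the two-state Markov chain. -/
noncomputable def mmahhTrans {n : ℕ} (f : Point n → ℝ) (p q : ℝ) :
    Point n × Op → Point n × Op → ℝ≥0∞ :=
  fun s s' => moveProb f s.2 s.1 s'.1 * switchProb p q s.2 s'.2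

/-- `X` is (a version of) the MMAHH Markov chain with objective function `f` and switching
probabilities `p` and `q`, under the measure `μ`: each `X t` is measurable, and conditionally
on any history, the next state is distributed according to `mmahhTrans`. -/
def IsMMAHH {n : ℕ} {Ω : Type*} [MeasurableSpace Ω] (μ : Measure Ω)
    (X : ℕ → Ω → Point n × Op) (f : Point n → ℝ) (p q : ℝ) : Prop :=
  (∀ t, Measurable (X t)) ∧
  ∀ (t : ℕ) (σ : ℕ → Point n × Op) (s' : Point n × Op),
    μ {ω | (∀ i ≤ t, X i ω = σ i) ∧ X (t + 1) ω = s'}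
      = μ {ω | ∀ i ≤ t, X i ω = σ i} * mmahhTrans f p q (σ t) s'

/-- The runtime: the first hitting time of the global optimum, as an extended natural number
(`⊤` if the optimum is never reached). -/
noncomputable def hitTime {n : ℕ} {Ω : Type*} (X : ℕ → Ω → Point n × Op) (ω : Ω) : ℕ∞ :=
  ⨅ t ∈ {t : ℕ | (X t ω).1 = optimum n}, (t : ℕ∞)

/-- The `k`-th switching time between the two acceptance operators (with junk value given by
`Nat.sInf ∅ = 0` on the probability-zero event that no further switch occurs). -/
noncomputable def switchTime {n : ℕ} {Ω : Type*} (X : ℕ → Ω → Point n × Op) : ℕ → Ω → ℕ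
  | 0, _ => 0
  | k + 1, ω =>
      sInf {t : ℕ | switchTime X k ω ≤ t ∧ (X t ω).2 ≠ (X (switchTime X k ω) ω).2}

/-- The Jump benchmark with gap parameter `m`. -/
noncomputable def Jump (n m : ℕ) (x : Point n) : ℝ :=
  if ones x ≤ n - m ∨ ones x = n then (m : ℝ) + (ones x : ℝ) else (n : ℝ) - (ones x : ℝ)

/-- Lower bound on the success probability of an attempt. -/
noncomputable def sg (n : ℕ) (q : ℝ) (y : ℕ) : ℝ :=
  (y.factorial : ℝ) / (n : ℝ) ^ y * (1 - q) ^ (y - 2)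

/-- The potential function on layers. -/
noncomputable def pot (n m : ℕ) (q B K φ τ : ℝ) (y : ℕ) (o : Op) : ℝ :=
  if y = 0 then 0
  else if y ≤ m then
    match o with
    | Op.OI => if y = 1 then B * (1 - 1 / n) else B
    | Op.AM => B * (1 - sg n q y) + τ
  else
    match o with
    | Op.OI => B + K * n * (y - m)
    | Op.AM => B + K * n * (y - m) + K * φ * (n - 2 * y) + 1 / q

lemma sg_succ_le {n : ℕ} {q : ℝ} (hq : 0 < q) (hq1 : q < 1) {y : ℕ} (hy : y + 1 ≤ n) :
    sg n q (y + 1) ≤ sg n q y := by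
  unfold sg
  have hn : (0 : ℝ) < n := by exact_mod_cast (by omega : 0 < n)
  have hyn : ((y : ℝ) + 1) ≤ n := by exact_mod_cast hy
  have h1 : ((y + 1).factorial : ℝ) / (n : ℝ) ^ (y + 1) ≤ (y.factorial : ℝ) / (n : ℝ) ^ y := by
    rw [div_le_div_iff₀ (by positivity) (by positivity), Nat.factorial_succ]
    push_cast
    have : (0 : ℝ) ≤ y.factorial * (n : ℝ) ^ y := by positivity
    rw [pow_succ]
    nlinarith
  have h2 : (1 - q) ^ (y + 1 - 2) ≤ (1 - q) ^ (y - 2) :=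
    pow_le_pow_of_le_one (by linarith) (by linarith) (by omega)
  have h3 : (0 : ℝ) ≤ (1 - q) ^ (y + 1 - 2) := pow_nonneg (by linarith) _
  exact mul_le_mul h1 h2 h3 (by positivity)

lemma sg_anti {n : ℕ} {q : ℝ} (hq : 0 < q) (hq1 : q < 1) {y m : ℕ} (hym : y ≤ m) (hm : m ≤ n) :
    sg n q m ≤ sg n q y := by
  induction m, hym using Nat.le_induction with
  | base => exact le_rfl
  | succ k hk ih => exact (sg_succ_le hq hq1 hm).trans (ih (by omega))

lemma sg_zero (n : ℕ) (q : ℝ) : sg n q 0 = 1 := by simp [sg]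

lemma sg_one (n : ℕ) (q : ℝ) : sg n q 1 = 1 / n := by simp [sg]

lemma sg_pos {n : ℕ} {q : ℝ} (hn : 0 < n) (hq1 : q < 1) (y : ℕ) : 0 < sg n q y := by
  unfold sg
  have : (0 : ℝ) < n := by exact_mod_cast hn
  have : 0 < (1 - q) := by linarith
  positivity

lemma sg_step {n : ℕ} {q : ℝ} {y : ℕ} (hn : 0 < n) (hy : 3 ≤ y) :
    sg n q y = (y / n) * (1 - q) * sg n q (y - 1) := by
  obtain ⟨k, rfl⟩ : ∃ k, y = k + 3 := ⟨y - 3, by omega⟩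
  have : (0 : ℝ) < n := by exact_mod_cast hn
  simp only [sg, show k + 3 - 1 = k + 2 by omega, show k + 3 - 2 = k + 1 by omega,
    show k + 2 - 2 = k by omega]
  rw [Nat.factorial_succ (k + 2)]
  push_cast
  field_simp
  ring

lemma sg_two (n : ℕ) (q : ℝ) : sg n q 2 = 2 / n * (1 / n) := by
  simp [sg, Nat.factorial]
  ring

/-- Parameter conditions used for the potential. -/
structure Good (n m : ℕ) (p q B K φ τ : ℝ) : Prop where
  hm : 2 ≤ m
  hmn : 2 * m < n
  hp : 0 < p
  hp1 : p < 1
  hq : 0 < q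
  hq1 : q < 1
  hφ : 0 < φ
  hφn : φ ≤ n / 2
  hφ1 : φ * (q + 2 * (1 - q) / n) = 1
  hφm : p * φ * (n - 2 * m) ≤ m
  hK : K = 1 + p / q
  hτ : τ = K * n + K * φ * (n - 2 * m) + 1 / q + 2
  hB : B * sg n q m = τ + 2 / p

section
variable {n m : ℕ} {p q B K φ τ : ℝ}

lemma Good.nR (h : Good n m p q B K φ τ) : (0 : ℝ) < n := by
  have := h.hmn
  exact_mod_cast (by omega : 0 < n)

lemma Good.mn (h : Good n m p q B K φ τ) : (2 * m + 1 : ℝ) ≤ n := by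
  have := h.hmn
  exact_mod_cast (by omega : 2 * m + 1 ≤ n)

lemma Good.mR (h : Good n m p q B K φ τ) : (2 : ℝ) ≤ m := by
  exact_mod_cast h.hm

lemma Good.K1 (h : Good n m p q B K φ τ) : 1 ≤ K := by
  have := h.hp; have := h.hq
  have : 0 ≤ p / q := by positivity
  linarith [h.hK]

lemma Good.τ1 (h : Good n m p q B K φ τ) : 1 / q ≤ τ := by
  have h1 := h.K1; have h2 := h.nR; have h3 := h.mn; have h4 := h.hφ
  have : 0 ≤ K * n := by positivity
  have : 0 ≤ K * φ * (n - 2 * m) := mul_nonneg (by positivity) (by linarith)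
  linarith [h.hτ]

lemma Good.τ0 (h : Good n m p q B K φ τ) : 0 ≤ τ := by
  have := h.hq
  have : 0 ≤ 1 / q := by positivity
  linarith [h.τ1]

lemma Good.npos (h : Good n m p q B K φ τ) : 0 < n := by
  have := h.hmn
  omega

lemma Good.B0 (h : Good n m p q B K φ τ) : 0 ≤ B := by
  have h1 := sg_pos h.npos h.hq1 m
  have h2 := h.τ0
  have h3 := h.hp
  have h4 : 0 ≤ B * sg n q m := by rw [h.hB]; positivity
  nlinarith

lemma Good.Bsg (h : Good n m p q B K φ τ) {y : ℕ} (hy : y ≤ m) :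
    τ + 2 / p ≤ B * sg n q y := by
  rw [← h.hB]
  exact mul_le_mul_of_nonneg_left (sg_anti h.hq h.hq1 hy (by have := h.hmn; omega)) h.B0

lemma Good.sg_le_one (h : Good n m p q B K φ τ) {y : ℕ} (hy : y ≤ m) : sg n q y ≤ 1 := by
  rw [← sg_zero n q]
  exact sg_anti h.hq h.hq1 (Nat.zero_le _) (by have := h.hmn; omega)

lemma pot_zero (o : Op) : pot n m q B K φ τ 0 o = 0 := by simp [pot]

lemma Good.pot_one_OI (h : Good n m p q B K φ τ) :
    pot n m q B K φ τ 1 Op.OI = B * (1 - 1 / n) := by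
  have := h.hm
  simp [pot, show 1 ≤ m by omega]

lemma pot_OI_le {y : ℕ} (h2 : 2 ≤ y) (hy : y ≤ m) : pot n m q B K φ τ y Op.OI = B := by
  simp [pot, show y ≠ 0 by omega, show y ≠ 1 by omega, hy]

lemma pot_AM_le {y : ℕ} (h2 : 1 ≤ y) (hy : y ≤ m) :
    pot n m q B K φ τ y Op.AM = B * (1 - sg n q y) + τ := by
  simp [pot, show y ≠ 0 by omega, hy]

lemma pot_OI_gt {y : ℕ} (hy : m < y) : pot n m q B K φ τ y Op.OI = B + K * n * (y - m) := by
  simp [pot, show y ≠ 0 by omega, show ¬ y ≤ m by omega]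

lemma pot_AM_gt {y : ℕ} (hy : m < y) : pot n m q B K φ τ y Op.AM =
    B + K * n * (y - m) + K * φ * (n - 2 * y) + 1 / q := by
  simp [pot, show y ≠ 0 by omega, show ¬ y ≤ m by omega]

lemma Good.pot_OI_ge (h : Good n m p q B K φ τ) {y : ℕ} (hy : m ≤ y) :
    pot n m q B K φ τ y Op.OI = B + K * n * (y - m) := by
  rcases hy.eq_or_lt with rfl | hy
  · rw [pot_OI_le h.hm le_rfl]; ring
  · exact pot_OI_gt hy

lemma Good.pot_AM_ge (h : Good n m p q B K φ τ) {y : ℕ} (hy : m ≤ y) :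
    pot n m q B K φ τ y Op.AM ≤ B + K * n * (y - m) + K * φ * (n - 2 * y) + 1 / q := by
  rcases hy.eq_or_lt with rfl | hy
  · have := h.hm
    rw [pot_AM_le (by omega) le_rfl]
    have h1 := h.hB
    have h2 := h.hτ
    have h3 := h.hp
    have h4 := h.K1
    have h5 := h.nR
    have : 0 ≤ 2 / p := by positivity
    have : 2 ≤ 2 / p := by rw [le_div_iff₀ h3]; linarith [h.hp1]
    have : 0 ≤ K * φ * (n - 2 * m) :=
      mul_nonneg (by have := h.hφ; positivity) (by linarith [h.mn])
    have : 0 ≤ 1 / q := by have := h.hq; positivity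
    linarith
  · exact (pot_AM_gt hy).le

lemma Good.pot_nonneg (h : Good n m p q B K φ τ) {y : ℕ} (hyn : y ≤ n) (o : Op) :
    0 ≤ pot n m q B K φ τ y o := by
  have hB := h.B0
  have hn := h.nR
  have hK := h.K1
  have hφ := h.hφ
  have hq := h.hq
  have hm := h.mR
  have hmn := h.mn
  have hyn' : (y : ℝ) ≤ n := by exact_mod_cast hyn
  rcases Nat.eq_zero_or_pos y with rfl | hy
  · rw [pot_zero]
  rcases le_or_gt y m with hym | hym
  · cases o
    · rcases (show 1 ≤ y from hy).eq_or_lt with rfl | hy2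
      · rw [h.pot_one_OI]
        apply mul_nonneg hB
        rw [sub_nonneg, div_le_iff₀ hn]
        linarith
      · rw [pot_OI_le hy2 hym]; exact hB
    · rw [pot_AM_le hy hym]
      have := h.sg_le_one hym
      have := h.τ0
      have : 0 ≤ B * (1 - sg n q y) := mul_nonneg hB (by linarith)
      linarith
  · have hym' : (m : ℝ) + 1 ≤ y := by exact_mod_cast hym
    have h1 : 0 ≤ K * n * (y - m) := mul_nonneg (by positivity) (by linarith)
    cases o
    · rw [pot_OI_gt hym]; linarith
    · rw [pot_AM_gt hym]
      have h3 := h.hφn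
      have h2 : 0 ≤ n * (y - m) + φ * (n - 2 * y) := by
        nlinarith
      have h4 : 0 ≤ K * (n * (y - m) + φ * (n - 2 * y)) := mul_nonneg (by linarith) h2
      have : 0 ≤ 1 / q := by positivity
      linarith

/-- Expected potential after an operator switch. -/
noncomputable def mixPot (n m : ℕ) (p q B K φ τ : ℝ) (o : Op) (y : ℕ) : ℝ :=
  match o with
  | Op.OI => (1 - p) * pot n m q B K φ τ y Op.OI + p * pot n m q B K φ τ y Op.AM
  | Op.AM => q * pot n m q B K φ τ y Op.OI + (1 - q) * pot n m q B K φ τ y Op.AM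

lemma mixPot_zero (o : Op) : mixPot n m p q B K φ τ o 0 = 0 := by
  cases o <;> simp [mixPot, pot_zero]

lemma Good.mix_AM_ge (h : Good n m p q B K φ τ) {y : ℕ} (hy : m ≤ y) :
    mixPot n m p q B K φ τ Op.AM y ≤
      B + K * n * (y - m) + (1 - q) * (K * φ * (n - 2 * y) + 1 / q) := by
  simp only [mixPot]
  have h1 := h.pot_OI_ge hy
  have h2 := mul_le_mul_of_nonneg_left (h.pot_AM_ge hy) (by linarith [h.hq1] : 0 ≤ 1 - q)
  rw [h1]
  linarith

lemma Good.mix_OI_ge (h : Good n m p q B K φ τ) {y : ℕ} (hy : m ≤ y) :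
    mixPot n m p q B K φ τ Op.OI y ≤
      B + K * n * (y - m) + p * (K * φ * (n - 2 * y) + 1 / q) := by
  simp only [mixPot]
  have h1 := h.pot_OI_ge hy
  have h2 := mul_le_mul_of_nonneg_left (h.pot_AM_ge hy) h.hp.le
  rw [h1]
  linarith

lemma Good.mix_OI_le (h : Good n m p q B K φ τ) {y : ℕ} (hy2 : 2 ≤ y) (hy : y ≤ m) :
    mixPot n m p q B K φ τ Op.OI y ≤ B - 2 := by
  simp only [mixPot]
  rw [pot_OI_le hy2 hy, pot_AM_le (by omega) hy]
  have h1 := h.Bsg hy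
  have hp := h.hp
  have h2 : p * (τ + 2 / p - B * sg n q y) ≤ 0 :=
    mul_nonpos_of_nonneg_of_nonpos hp.le (by linarith)
  have h3 : p * (2 / p) = 2 := by field_simp
  nlinarith

/-- Drift for `AM` above the gap. -/
lemma Good.drift_AM_gt (h : Good n m p q B K φ τ) {y : ℕ} (hy : m < y) (hyn : y ≤ n) :
    (y : ℝ) / n * mixPot n m p q B K φ τ Op.AM (y - 1) +
      (1 - (y : ℝ) / n) * mixPot n m p q B K φ τ Op.AM (y + 1) + 1 ≤
      pot n m q B K φ τ y Op.AM := by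
  have hn := h.nR
  have hyn' : (y : ℝ) ≤ n := by exact_mod_cast hyn
  have h1 := h.mix_AM_ge (y := y - 1) (by omega)
  have h2 := h.mix_AM_ge (y := y + 1) (by omega)
  rw [Nat.cast_sub (by omega : 1 ≤ y)] at h1
  push_cast at h1 h2
  rw [pot_AM_gt hy]
  have e1 : (0 : ℝ) ≤ (y : ℝ) / n := by positivity
  have e2 : (0 : ℝ) ≤ 1 - (y : ℝ) / n := by
    rw [sub_nonneg, div_le_iff₀ hn]; linarith
  have h3 := mul_le_mul_of_nonneg_left h1 e1
  have h4 := mul_le_mul_of_nonneg_left h2 e2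
  have hφ1 := h.hφ1
  have hq := h.hq
  have hqi : q * (1 / q) = 1 := by field_simp
  have hyd : (y : ℝ) / n * n = y := by field_simp
  have key : (y : ℝ) / n * (B + K * n * ((y - 1 : ℝ) - m) +
        (1 - q) * (K * φ * (n - 2 * (y - 1 : ℝ)) + 1 / q)) +
      (1 - (y : ℝ) / n) * (B + K * n * ((y + 1 : ℝ) - m) +
        (1 - q) * (K * φ * (n - 2 * (y + 1 : ℝ)) + 1 / q)) + 1 =
      B + K * n * (y - m) + K * φ * (n - 2 * y) + 1 / q := by
    field_simp at hφ1 ⊢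
    linear_combination (-K * q * (n - 2 * y)) * hφ1
  linarith

/-- Drift for `OI` above the gap. -/
lemma Good.drift_OI_gt (h : Good n m p q B K φ τ) {y : ℕ} (hy : m < y) (hyn : y ≤ n) :
    (y : ℝ) / n * mixPot n m p q B K φ τ Op.OI (y - 1) +
      (1 - (y : ℝ) / n) * mixPot n m p q B K φ τ Op.OI y + 1 ≤
      pot n m q B K φ τ y Op.OI := by
  have hn := h.nR
  have hyn' : (y : ℝ) ≤ n := by exact_mod_cast hyn
  have hym' : (m : ℝ) + 1 ≤ y := by exact_mod_cast hy
  have h1 := h.mix_OI_ge (y := y - 1) (by omega)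
  have h2 := h.mix_OI_ge (y := y) (by omega)
  rw [Nat.cast_sub (by omega : 1 ≤ y)] at h1
  push_cast at h1 h2
  rw [pot_OI_gt hy]
  have e1 : (0 : ℝ) ≤ (y : ℝ) / n := by positivity
  have e2 : (0 : ℝ) ≤ 1 - (y : ℝ) / n := by
    rw [sub_nonneg, div_le_iff₀ hn]; linarith
  have e3 : (y : ℝ) / n ≤ 1 := by linarith
  have h3 := mul_le_mul_of_nonneg_left h1 e1
  have h4 := mul_le_mul_of_nonneg_left h2 e2
  have hp := h.hp
  have hq := h.hq
  have hK := h.hK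
  have hK1 := h.K1
  have hφ := h.hφ
  have key : (y : ℝ) / n * (B + K * n * ((y - 1 : ℝ) - m) +
        p * (K * φ * (n - 2 * (y - 1 : ℝ)) + 1 / q)) +
      (1 - (y : ℝ) / n) * (B + K * n * (y - m) +
        p * (K * φ * (n - 2 * y) + 1 / q)) =
      B + K * n * (y - m) - K * (y - p * φ * ((n - 2 * y) + 2 * (y / n))) + p * (1 / q) := by
    field_simp
    ring
  have hb : p * φ * ((n - 2 * y) + 2 * (y / n)) ≤ p * φ * (n - 2 * m) := by
    apply mul_le_mul_of_nonneg_left _ (by positivity)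
    linarith
  have h5 : 1 ≤ y - p * φ * ((n - 2 * y) + 2 * (y / n)) := by
    linarith [h.hφm]
  have h6 : K ≤ K * (y - p * φ * ((n - 2 * y) + 2 * (y / n))) := by
    nlinarith
  have h7 : p / q = p * (1 / q) := by ring
  linarith

lemma Good.drift_OI_m (h : Good n m p q B K φ τ) :
    mixPot n m p q B K φ τ Op.OI m + 1 ≤ pot n m q B K φ τ m Op.OI := by
  rw [pot_OI_le h.hm le_rfl]
  linarith [h.mix_OI_le h.hm le_rfl]

lemma Good.drift_OI_lt (h : Good n m p q B K φ τ) {y : ℕ} (hy2 : 2 ≤ y) (hy : y < m) :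
    (y : ℝ) / n * mixPot n m p q B K φ τ Op.OI y +
      (1 - (y : ℝ) / n) * mixPot n m p q B K φ τ Op.OI (y + 1) + 1 ≤
      pot n m q B K φ τ y Op.OI := by
  rw [pot_OI_le hy2 hy.le]
  have hn := h.nR
  have hyn' : (y : ℝ) ≤ n := by
    have := h.hmn
    exact_mod_cast (by omega : y ≤ n)
  have e1 : (0 : ℝ) ≤ (y : ℝ) / n := by positivity
  have e2 : (0 : ℝ) ≤ 1 - (y : ℝ) / n := by
    rw [sub_nonneg, div_le_iff₀ hn]; linarith
  have h3 := mul_le_mul_of_nonneg_left (h.mix_OI_le hy2 hy.le) e1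
  have h4 := mul_le_mul_of_nonneg_left (h.mix_OI_le (y := y + 1) (by omega) hy) e2
  linarith

lemma Good.drift_OI_one (h : Good n m p q B K φ τ) :
    ((1 : ℕ) : ℝ) / n * mixPot n m p q B K φ τ Op.OI 0 +
      (1 - ((1 : ℕ) : ℝ) / n) * mixPot n m p q B K φ τ Op.OI 2 + 1 ≤
      pot n m q B K φ τ 1 Op.OI := by
  rw [h.pot_one_OI, mixPot_zero]
  have hn := h.nR
  have h1 := h.mix_OI_le (y := 2) le_rfl h.hm
  have e3 : (1 : ℝ) / n ≤ 1 / 2 := by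
    apply one_div_le_one_div_of_le (by norm_num)
    linarith [h.mn, h.mR]
  push_cast
  have := mul_le_mul_of_nonneg_left h1 (by linarith : 0 ≤ 1 - (1 : ℝ) / n)
  linarith

/-- Mixed potential for `AM` in the gap region, first bound. -/
lemma Good.mix_AM_le (h : Good n m p q B K φ τ) {y : ℕ} (hy2 : 1 ≤ y) (hy : y ≤ m) :
    mixPot n m p q B K φ τ Op.AM y ≤ B - (1 - q) * (B * sg n q y) + τ - 1 := by
  have hq := h.hq
  have hB := h.B0
  have hn := h.nR
  have h1 : pot n m q B K φ τ y Op.OI ≤ B := by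
    rcases hy2.eq_or_lt with rfl | hy2
    · rw [h.pot_one_OI]
      have : 0 ≤ B * (1 / n) := by positivity
      linarith
    · rw [pot_OI_le hy2 hy]
  have h2 := mul_le_mul_of_nonneg_left h1 hq.le
  simp only [mixPot]
  rw [pot_AM_le hy2 hy]
  have h3 : 1 ≤ q * τ := by
    have := mul_le_mul_of_nonneg_left h.τ1 hq.le
    rwa [show q * (1 / q) = 1 by field_simp] at this
  linarith

lemma Good.mix_AM_one (h : Good n m p q B K φ τ) :
    mixPot n m p q B K φ τ Op.AM 1 ≤ B - B * (1 / n) + τ - 1 := by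
  have hq := h.hq
  have := h.hm
  simp only [mixPot]
  rw [pot_AM_le le_rfl (by omega), h.pot_one_OI, sg_one]
  have h3 : 1 ≤ q * τ := by
    have := mul_le_mul_of_nonneg_left h.τ1 hq.le
    rwa [show q * (1 / q) = 1 by field_simp] at this
  linarith

/-- Going up from the gap region. -/
lemma Good.mix_AM_up (h : Good n m p q B K φ τ) {y : ℕ} (hy2 : 1 ≤ y) (hy : y ≤ m) :
    mixPot n m p q B K φ τ Op.AM (y + 1) ≤ B + τ - (if y = m then 2 else 1) := by
  have hq := h.hq
  have hq1 := h.hq1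
  have hB := h.B0
  split_ifs with hc
  · subst hc
    have h1 := h.mix_AM_ge (y := y + 1) (by omega)
    push_cast at h1
    have h2 := h.hτ
    have hK := h.K1
    have hφ := h.hφ
    have e0 : 0 ≤ K * φ := by positivity
    have e1 : 0 ≤ K * φ * (n - 2 * y) := mul_nonneg e0 (by linarith [h.mn])
    have e2 : 0 ≤ 1 / q := by positivity
    have e3 : (1 - q) * (K * φ * (n - 2 * (y + 1)) + 1 / q) ≤ K * φ * (n - 2 * y) + 1 / q := by
      have : (1 - q) * (K * φ * (n - 2 * (y + 1)) + 1 / q) ≤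
          (1 - q) * (K * φ * (n - 2 * y) + 1 / q) := by
        apply mul_le_mul_of_nonneg_left _ (by linarith)
        linarith
      nlinarith
    linarith
  · have h1 := h.mix_AM_le (y := y + 1) (by omega) (by omega)
    have h2 := sg_pos h.npos h.hq1 (y + 1)
    have : 0 ≤ (1 - q) * (B * sg n q (y + 1)) := mul_nonneg (by linarith) (by positivity)
    linarith

lemma Good.drift_AM_le (h : Good n m p q B K φ τ) {y : ℕ} (hy1 : 1 ≤ y) (hy : y ≤ m) :
    (y : ℝ) / n * mixPot n m p q B K φ τ Op.AM (y - 1) +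
      (1 - (y : ℝ) / n) * mixPot n m p q B K φ τ Op.AM (y + 1) + 1 ≤
      pot n m q B K φ τ y Op.AM := by
  have hn := h.nR
  have hB := h.B0
  have hτ := h.τ1
  have hq := h.hq
  have hq1 := h.hq1
  have hmn := h.mn
  have hym' : (y : ℝ) ≤ m := by exact_mod_cast hy
  have e1 : (0 : ℝ) ≤ (y : ℝ) / n := by positivity
  have e3 : (y : ℝ) / n ≤ 1 / 2 := by
    rw [div_le_iff₀ hn]; linarith
  have e2 : (0 : ℝ) ≤ 1 - (y : ℝ) / n := by linarith
  have hup := h.mix_AM_up hy1 hy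
  have hdown : (y : ℝ) / n * mixPot n m p q B K φ τ Op.AM (y - 1) ≤
      (y : ℝ) / n * (B + τ - 1) - B * sg n q y := by
    rcases (by omega : y = 1 ∨ y = 2 ∨ 3 ≤ y) with rfl | rfl | h3
    · rw [show 1 - 1 = 0 from rfl, mixPot_zero, sg_one]
      have : 1 ≤ 1 / q := by rw [le_div_iff₀ hq]; linarith
      have : 0 ≤ ((1 : ℕ) : ℝ) / n * (τ - 1) := mul_nonneg e1 (by linarith)
      push_cast at *
      linarith
    · have := mul_le_mul_of_nonneg_left h.mix_AM_one e1
      rw [sg_two]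
      push_cast at *
      linarith
    · have := mul_le_mul_of_nonneg_left (h.mix_AM_le (y := y - 1) (by omega) (by omega)) e1
      rw [sg_step h.npos h3]
      linarith
  rw [pot_AM_le hy1 hy]
  have h4 := mul_le_mul_of_nonneg_left hup e2
  split_ifs at h4 with hc
  · linarith
  · linarith

end
instance : Fintype Op := ⟨{Op.OI, Op.AM}, fun o => by cases o <;> simp⟩

instance : MeasurableSingletonClass Op := ⟨fun _ => trivial⟩

lemma sum_Op {M : Type*} [AddCommMonoid M] (g : Op → M) : ∑ o, g o = g Op.OI + g Op.AM := by
  change ∑ o ∈ ({Op.OI, Op.AM} : Finset Op), g o = _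
  rw [Finset.sum_pair (by simp)]

/-- The Markov property, for events depending on the history. -/
lemma markov_event {n : ℕ} {Ω : Type*} [MeasurableSpace Ω] (μ : Measure Ω)
    (X : ℕ → Ω → Point n × Op) (f : Point n → ℝ) (p q : ℝ) (hX : IsMMAHH μ X f p q)
    (t : ℕ) (s s' : Point n × Op) :
    μ {ω | (∀ i ≤ t, (X i ω).1 ≠ optimum n) ∧ X t ω = s ∧ X (t + 1) ω = s'} =
      μ {ω | (∀ i ≤ t, (X i ω).1 ≠ optimum n) ∧ X t ω = s} * mmahhTrans f p q s s' := by
  classical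
  obtain ⟨hmeas, hM⟩ := hX
  let H : Ω → (Fin (t + 1) → Point n × Op) := fun ω i => X i ω
  have hH : Measurable H := measurable_pi_lambda _ fun i => hmeas i
  let F : Finset (Fin (t + 1) → Point n × Op) :=
    Finset.univ.filter fun h => (∀ i, (h i).1 ≠ optimum n) ∧ h (Fin.last t) = s
  have hF : ∀ ω, H ω ∈ F ↔ ((∀ i ≤ t, (X i ω).1 ≠ optimum n) ∧ X t ω = s) := by
    intro ω
    simp only [F, H, Finset.mem_filter, Finset.mem_univ, true_and, Fin.val_last]
    constructor
    · rintro ⟨h1, h2⟩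
      exact ⟨fun i hi => h1 ⟨i, by omega⟩, h2⟩
    · rintro ⟨h1, h2⟩
      exact ⟨fun i => h1 i (by omega), h2⟩
  have hsing : ∀ h : Fin (t + 1) → Point n × Op, MeasurableSet (H ⁻¹' {h}) :=
    fun h => hH (measurableSet_singleton h)
  have hS' : MeasurableSet {ω | X (t + 1) ω = s'} :=
    hmeas (t + 1) (measurableSet_singleton s')
  have e1 : {ω | (∀ i ≤ t, (X i ω).1 ≠ optimum n) ∧ X t ω = s} = ⋃ h ∈ F, H ⁻¹' {h} := by
    ext ω
    simp only [Set.mem_ofPred_eq, ← hF, Set.mem_iUnion, Set.mem_preimage, Set.mem_singleton_iff,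
      exists_prop, exists_eq_right']
  have e2 : {ω | (∀ i ≤ t, (X i ω).1 ≠ optimum n) ∧ X t ω = s ∧ X (t + 1) ω = s'} =
      ⋃ h ∈ F, (H ⁻¹' {h} ∩ {ω | X (t + 1) ω = s'}) := by
    ext ω
    simp only [Set.mem_ofPred_eq, ← and_assoc, ← hF, Set.mem_iUnion, Set.mem_preimage,
      Set.mem_singleton_iff, exists_prop, Set.mem_inter_iff]
    constructor
    · rintro ⟨a, b⟩
      exact ⟨_, ⟨a, rfl⟩, b⟩
    · rintro ⟨h, ⟨a, rfl⟩, b⟩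
      exact ⟨a, b⟩
  have dj : ((F : Set _)).PairwiseDisjoint fun h => H ⁻¹' {h} := by
    intro a _ b _ hab
    refine Set.disjoint_left.2 fun ω h1 h2 => hab ?_
    exact (Set.mem_singleton_iff.1 h1).symm.trans (Set.mem_singleton_iff.1 h2)
  have dj2 : ((F : Set _)).PairwiseDisjoint fun h => H ⁻¹' {h} ∩ {ω | X (t + 1) ω = s'} :=
    fun a ha b hb hab => (dj ha hb hab).mono Set.inter_subset_left Set.inter_subset_left
  rw [e1, e2, measure_biUnion_finset dj fun h _ => hsing h,
    measure_biUnion_finset dj2 fun h _ => (hsing h).inter hS', Finset.sum_mul]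
  refine Finset.sum_congr rfl fun h hh => ?_
  let σ : ℕ → Point n × Op := fun i => if hi : i < t + 1 then h ⟨i, hi⟩ else s
  have e3 : H ⁻¹' {h} = {ω | ∀ i ≤ t, X i ω = σ i} := by
    ext ω
    simp only [Set.mem_preimage, Set.mem_singleton_iff, Set.mem_ofPred_eq, H, σ]
    constructor
    · intro hw i hi
      rw [dif_pos (by omega : i < t + 1), ← hw]
    · intro hw
      funext i
      have := hw i (by omega)
      rwa [dif_pos i.2] at this
  have e4 : σ t = s := by
    have : h (Fin.last t) = s := (Finset.mem_filter.1 hh).2.2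
    simp only [σ]
    rw [dif_pos (by omega)]
    exact this
  have := hM t σ s'
  rw [e4] at this
  rw [e3, ← this]
  rfl

/-- Additive drift theorem for the chain. -/
lemma drift_bound {n : ℕ} {Ω : Type*} [MeasurableSpace Ω] (μ : Measure Ω)
    (X : ℕ → Ω → Point n × Op) (f : Point n → ℝ) (p q : ℝ) (hX : IsMMAHH μ X f p q)
    (U : Point n × Op → ℝ≥0∞)
    (hU : ∀ s : Point n × Op, s.1 ≠ optimum n → ∑ s', mmahhTrans f p q s s' * U s' + 1 ≤ U s) :
    ∫⁻ ω, (hitTime X ω : ℝ≥0∞) ∂μ ≤ ∑ s, μ {ω | X 0 ω = s} * U s := by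
  classical
  have hmeas := hX.1
  let A : ℕ → Set Ω := fun t => {ω | ∀ i ≤ t, (X i ω).1 ≠ optimum n}
  let a : ℕ → Point n × Op → ℝ≥0∞ :=
    fun t s => μ {ω | (∀ i ≤ t, (X i ω).1 ≠ optimum n) ∧ X t ω = s}
  have hnon : ∀ i, MeasurableSet {ω | (X i ω).1 ≠ optimum n} := fun i =>
    (measurable_fst.comp (hmeas i)) (measurableSet_singleton (optimum n)).compl
  have hA : ∀ t, MeasurableSet (A t) := by
    intro t
    have : A t = ⋂ i ∈ Set.Iic t, {ω | (X i ω).1 ≠ optimum n} := by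
      ext ω; simp [A]
    rw [this]
    exact MeasurableSet.biInter (Set.to_countable _) fun i _ => hnon i
  have hsing : ∀ t s, MeasurableSet {ω | X t ω = s} := fun t s =>
    hmeas t (measurableSet_singleton s)
  have hsplit : ∀ (E : Set Ω) (t : ℕ), MeasurableSet E →
      μ E = ∑ s, μ (E ∩ {ω | X t ω = s}) := by
    intro E t hE
    rw [← measure_biUnion_finset]
    · congr 1
      ext ω
      simp
    · intro a _ b _ hab
      refine Set.disjoint_left.2 fun ω h1 h2 => hab (h1.2.symm.trans h2.2)
    · intro s _
      exact hE.inter (hsing t s)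
  have hAa : ∀ t, μ (A t) = ∑ s, a t s := fun t => hsplit (A t) t (hA t)
  have hazero : ∀ t s, s.1 = optimum n → a t s = 0 := by
    intro t s hs
    have : {ω | (∀ i ≤ t, (X i ω).1 ≠ optimum n) ∧ X t ω = s} = ∅ := by
      ext ω
      simp only [Set.mem_ofPred_eq, Set.mem_empty_iff_false, iff_false, not_and]
      intro h1 h2
      exact h1 t le_rfl (by rw [h2, hs])
    simp only [a, this, measure_empty]
  have hstep : ∀ t s', a (t + 1) s' ≤ ∑ s, a t s * mmahhTrans f p q s s' := by
    intro t s'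
    have h1 : a (t + 1) s' ≤ μ (A t ∩ {ω | X (t + 1) ω = s'}) := by
      apply measure_mono
      rintro ω ⟨h1, h2⟩
      exact ⟨fun i hi => h1 i (by omega), h2⟩
    refine h1.trans ?_
    rw [hsplit _ t ((hA t).inter (hsing _ _))]
    refine Finset.sum_le_sum fun s _ => ?_
    rw [← markov_event μ X f p q hX t s s']
    apply measure_mono
    rintro ω ⟨⟨h1, h2⟩, h3⟩
    exact ⟨h1, h3, h2⟩
  have hdec : ∀ t, ∑ s, a (t + 1) s * U s + μ (A t) ≤ ∑ s, a t s * U s := by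
    intro t
    calc ∑ s', a (t + 1) s' * U s' + μ (A t)
        ≤ ∑ s', (∑ s, a t s * mmahhTrans f p q s s') * U s' + ∑ s, a t s := by
          rw [hAa]
          gcongr with s' _
          exact hstep t s'
      _ = ∑ s, (a t s * (∑ s', mmahhTrans f p q s s' * U s' + 1)) := by
          simp_rw [Finset.sum_mul]
          rw [Finset.sum_comm, ← Finset.sum_add_distrib]
          refine Finset.sum_congr rfl fun s _ => ?_
          rw [mul_add, Finset.mul_sum, mul_one]
          simp_rw [mul_assoc]
      _ ≤ ∑ s, a t s * U s := by
          refine Finset.sum_le_sum fun s _ => ?_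
          by_cases hs : s.1 = optimum n
          · simp [hazero t s hs]
          · gcongr
            exact hU s hs
  have hsum : ∀ N, ∑ t ∈ Finset.range N, μ (A t) + ∑ s, a N s * U s ≤ ∑ s, a 0 s * U s := by
    intro N
    induction N with
    | zero => simp
    | succ N ih =>
      rw [Finset.sum_range_succ]
      refine le_trans ?_ ih
      rw [add_assoc]
      gcongr
      rw [add_comm]
      exact hdec N
  have hle : ∀ ω, (hitTime X ω : ℝ≥0∞) ≤ ∑' t, (A t).indicator 1 ω := by
    intro ω
    by_cases hex : ∃ t, (X t ω).1 = optimum n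
    · let T := Nat.find hex
      have hT : (X T ω).1 = optimum n := Nat.find_spec hex
      have h1 : hitTime X ω ≤ (T : ℕ∞) := iInf₂_le T hT
      have h2 : (hitTime X ω : ℝ≥0∞) ≤ ((T : ℕ∞) : ℝ≥0∞) := by exact_mod_cast h1
      refine h2.trans ?_
      refine le_trans ?_ (ENNReal.sum_le_tsum (Finset.range T))
      rw [Finset.sum_congr rfl (g := fun _ => 1)]
      · simp
      · intro t ht
        rw [Set.indicator_of_mem]
        · rfl
        · intro i hi
          exact Nat.find_min hex (by have := Finset.mem_range.1 ht; omega)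
    · have : ∀ t, (A t).indicator (1 : Ω → ℝ≥0∞) ω = 1 := by
        intro t
        rw [Set.indicator_of_mem]
        · rfl
        · intro i _ hi
          exact hex ⟨i, hi⟩
      simp [this]
  calc ∫⁻ ω, (hitTime X ω : ℝ≥0∞) ∂μ ≤ ∫⁻ ω, ∑' t, (A t).indicator 1 ω ∂μ := lintegral_mono hle
    _ = ∑' t, μ (A t) := by
        rw [lintegral_tsum]
        · refine tsum_congr fun t => ?_
          rw [lintegral_indicator_one (hA t)]
        · intro t
          exact (measurable_one.indicator (hA t)).aemeasurable
    _ ≤ ∑ s, a 0 s * U s := by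
        rw [ENNReal.tsum_eq_iSup_nat]
        exact iSup_le fun N => le_self_add.trans (hsum N)
    _ ≤ _ := by
        refine Finset.sum_le_sum fun s _ => ?_
        gcongr
        apply measure_mono
        rintro ω ⟨_, h⟩
        exact h

/-- Rewriting the expected potential as an average over the bit positions. -/
lemma sum_trans {n : ℕ} (f : Point n → ℝ) (p q : ℝ) (s : Point n × Op)
    (U : Point n × Op → ℝ≥0∞) :
    ∑ s', mmahhTrans f p q s s' * U s' =
      (∑ v : Fin n, ∑ o, switchProb p q s.2 o * U (movedPoint f s.2 s.1 v, o)) / n := by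
  classical
  rw [Fintype.sum_prod_type_right, Finset.sum_comm (s := Finset.univ (α := Fin n)),
    ENNReal.div_eq_inv_mul, Finset.mul_sum]
  refine Finset.sum_congr rfl fun o _ => ?_
  have h : ∀ x', mmahhTrans f p q s (x', o) * U (x', o) =
      ∑ v : Fin n, if movedPoint f s.2 s.1 v = x' then
        (n : ℝ≥0∞)⁻¹ * (switchProb p q s.2 o * U (movedPoint f s.2 s.1 v, o)) else 0 := by
    intro x'
    simp only [mmahhTrans, moveProb]
    have : ∀ v : Fin n, (if movedPoint f s.2 s.1 v = x' then
        (n : ℝ≥0∞)⁻¹ * (switchProb p q s.2 o * U (movedPoint f s.2 s.1 v, o)) else 0) =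
        (if movedPoint f s.2 s.1 v = x' then
        (n : ℝ≥0∞)⁻¹ * (switchProb p q s.2 o * U (x', o)) else 0) := by
      intro v
      split_ifs with hv
      · rw [hv]
      · rfl
    simp_rw [this]
    rw [← Finset.sum_filter, Finset.sum_const, nsmul_eq_mul, ENNReal.div_eq_inv_mul]
    have e : (Finset.univ.filter fun v => movedPoint f s.2 s.1 v = x').card =
      (Finset.univ.filter fun v => movedPoint f s.2 s.1 v = x').card := rfl
    ring
  simp_rw [h]
  rw [Finset.sum_comm, Finset.mul_sum]
  refine Finset.sum_congr rfl fun v _ => ?_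
  simp

/-- The number of zero-bits. -/
def zeros {n : ℕ} (x : Point n) : ℕ := (Finset.univ.filter fun i => x i = false).card

lemma ones_add_zeros {n : ℕ} (x : Point n) : ones x + zeros x = n := by
  unfold ones zeros
  have := Finset.card_filter_add_card_filter_not (s := (Finset.univ : Finset (Fin n)))
    (fun i => x i = true)
  simpa using this

lemma zeros_le {n : ℕ} (x : Point n) : zeros x ≤ n := by
  have := ones_add_zeros x
  omega

lemma zeros_pos {n : ℕ} (x : Point n) (h : x ≠ optimum n) : 1 ≤ zeros x := by
  by_contra hc
  apply h
  have h0 : zeros x = 0 := by omega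
  funext i
  unfold zeros at h0
  rw [Finset.card_eq_zero, Finset.filter_eq_empty_iff] at h0
  have := h0 (Finset.mem_univ i)
  simpa [optimum] using this

lemma zeros_flip_false {n : ℕ} (x : Point n) (v : Fin n) (hv : x v = false) :
    zeros (flipBit x v) = zeros x - 1 := by
  unfold zeros
  rw [← Finset.card_erase_of_mem (a := v) (by simp [hv])]
  congr 1
  ext i
  by_cases hi : i = v
  · subst hi; simp [flipBit, hv]
  · have hf : flipBit x v i = x i := Function.update_of_ne hi _ _
    simp [hf, hi]

lemma zeros_flip_true {n : ℕ} (x : Point n) (v : Fin n) (hv : x v = true) :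
    zeros (flipBit x v) = zeros x + 1 := by
  unfold zeros
  rw [← Finset.card_insert_of_notMem (a := v) (s := Finset.univ.filter fun i => x i = false)
    (by simp [hv])]
  congr 1
  ext i
  by_cases hi : i = v
  · subst hi; simp [flipBit, hv]
  · have hf : flipBit x v i = x i := Function.update_of_ne hi _ _
    simp [hf, hi]

lemma Jump_zeros {n m : ℕ} (hm : m ≤ n) (x : Point n) :
    Jump n m x = if m ≤ zeros x ∨ zeros x = 0 then (m : ℝ) + n - zeros x else (zeros x : ℝ) := by
  have h := ones_add_zeros x
  have h' : (n : ℝ) = ones x + zeros x := by exact_mod_cast h.symm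
  have hc : (ones x ≤ n - m ∨ ones x = n) ↔ (m ≤ zeros x ∨ zeros x = 0) := by omega
  unfold Jump
  simp only [hc, h']
  split_ifs <;> ring

/-- Averages over bits of functions with two values. -/
lemma sum_bits {n : ℕ} (x : Point n) (g : Fin n → ℝ) (a b : ℝ)
    (h0 : ∀ v, x v = false → g v = a) (h1 : ∀ v, x v = true → g v = b) (hn : 0 < n) :
    (∑ v, g v) / n = (zeros x : ℝ) / n * a + (1 - (zeros x : ℝ) / n) * b := by
  have hn' : (n : ℝ) ≠ 0 := by positivity
  have h : ∀ v, g v = (if x v = false then a else 0) + (if x v = true then b else 0) := by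
    intro v
    cases hv : x v
    · simp [h0 v hv]
    · simp [h1 v hv]
  have hz : (ones x : ℝ) = n - zeros x := by
    have : (ones x : ℝ) + zeros x = n := by exact_mod_cast ones_add_zeros x
    linarith
  simp_rw [h]
  rw [Finset.sum_add_distrib, ← Finset.sum_filter, ← Finset.sum_filter, Finset.sum_const,
    Finset.sum_const, nsmul_eq_mul, nsmul_eq_mul]
  change ((zeros x : ℝ) * a + (ones x : ℝ) * b) / n = _
  rw [hz]
  field_simp

section
variable {n m : ℕ} {p q B K φ τ : ℝ}

lemma Good.sum_le (h : Good n m p q B K φ τ) (x : Point n) (hx : x ≠ optimum n) (o : Op) :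
    (∑ v, mixPot n m p q B K φ τ o (zeros (movedPoint (Jump n m) o x v))) / n + 1 ≤
      pot n m q B K φ τ (zeros x) o := by
  have hz := zeros_pos x hx
  have hzn := zeros_le x
  have hm := h.hm
  have hmn := h.hmn
  have hmR := h.mR
  have hmnR := h.mn
  have hmn' : m ≤ n := by omega
  have hzR : (1 : ℝ) ≤ zeros x := by exact_mod_cast hz
  cases o
  · simp only [movedPoint]
    have c0 : ∀ v, x v = false →
        (Jump n m x < Jump n m (flipBit x v) ↔ (m < zeros x ∨ zeros x = 1)) := by
      intro v hv
      have e : ((zeros x - 1 : ℕ) : ℝ) = zeros x - 1 := by push_cast [hz]; ring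
      rw [Jump_zeros hmn', Jump_zeros hmn', zeros_flip_false x v hv, e]
      have hzR' : (zeros x : ℝ) ≤ n := by exact_mod_cast hzn
      rcases lt_trichotomy (zeros x) m with hlt | heq | hgt
      · have hltR : (zeros x : ℝ) < m := by exact_mod_cast hlt
        rw [if_neg (by omega)]
        by_cases h1 : zeros x = 1
        · rw [if_pos (by omega)]
          simp only [h1, or_true, iff_true]
          push_cast
          linarith
        · rw [if_neg (by omega)]
          constructor
          · intro hh; linarith
          · intro hh; omega
      · rw [if_pos (by omega), if_neg (by omega)]
        have heqR : (zeros x : ℝ) = m := by exact_mod_cast heq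
        constructor
        · intro hh; linarith
        · intro hh; omega
      · rw [if_pos (by omega), if_pos (by omega)]
        constructor
        · intro _; exact Or.inl hgt
        · intro _; linarith
    have c1 : ∀ v, x v = true →
        (Jump n m x < Jump n m (flipBit x v) ↔ zeros x < m) := by
      intro v hv
      have hzn2 : zeros x + 1 ≤ n := by
        rw [← zeros_flip_true x v hv]; exact zeros_le _
      have hzR' : (zeros x : ℝ) + 1 ≤ n := by exact_mod_cast hzn2
      rw [Jump_zeros hmn', Jump_zeros hmn', zeros_flip_true x v hv]
      push_cast
      rcases lt_or_ge (zeros x) m with hlt | hge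
      · have hltR : (zeros x : ℝ) + 1 ≤ m := by exact_mod_cast hlt
        rw [if_neg (by omega)]
        simp only [hlt, iff_true]
        split_ifs <;> linarith
      · rw [if_pos (by omega), if_pos (by omega)]
        constructor
        · intro hh; linarith
        · intro hh; omega
    rcases lt_trichotomy (zeros x) m with hlt | heq | hgt
    · by_cases h1 : zeros x = 1
      · rw [sum_bits x _ (mixPot n m p q B K φ τ Op.OI 0) (mixPot n m p q B K φ τ Op.OI 2)
          _ _ h.npos, h1]
        · exact h.drift_OI_one
        · intro v hv
          rw [if_pos ((c0 v hv).2 (Or.inr h1)), zeros_flip_false x v hv, h1]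
        · intro v hv
          rw [if_pos ((c1 v hv).2 hlt), zeros_flip_true x v hv, h1]
      · rw [sum_bits x _ (mixPot n m p q B K φ τ Op.OI (zeros x))
          (mixPot n m p q B K φ τ Op.OI (zeros x + 1)) _ _ h.npos]
        · exact h.drift_OI_lt (by omega) hlt
        · intro v hv
          rw [if_neg (by rw [c0 v hv]; omega)]
        · intro v hv
          rw [if_pos ((c1 v hv).2 hlt), zeros_flip_true x v hv]
    · rw [sum_bits x _ (mixPot n m p q B K φ τ Op.OI m)
          (mixPot n m p q B K φ τ Op.OI m) _ _ h.npos]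
      · have := h.drift_OI_m
        rw [heq]
        linarith
      · intro v hv
        rw [if_neg (by rw [c0 v hv]; omega), heq]
      · intro v hv
        rw [if_neg (by rw [c1 v hv]; omega), heq]
    · rw [sum_bits x _ (mixPot n m p q B K φ τ Op.OI (zeros x - 1))
          (mixPot n m p q B K φ τ Op.OI (zeros x)) _ _ h.npos]
      · exact h.drift_OI_gt hgt hzn
      · intro v hv
        rw [if_pos ((c0 v hv).2 (Or.inl hgt)), zeros_flip_false x v hv]
      · intro v hv
        rw [if_neg (by rw [c1 v hv]; omega)]
  · simp only [movedPoint]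
    rw [sum_bits x _ (mixPot n m p q B K φ τ Op.AM (zeros x - 1))
          (mixPot n m p q B K φ τ Op.AM (zeros x + 1)) _ _ h.npos]
    · rcases le_or_gt (zeros x) m with hle | hgt
      · exact h.drift_AM_le hz hle
      · exact h.drift_AM_gt hgt hzn
    · intro v hv
      rw [zeros_flip_false x v hv]
    · intro v hv
      rw [zeros_flip_true x v hv]

lemma Good.super (h : Good n m p q B K φ τ) (s : Point n × Op) (hs : s.1 ≠ optimum n) :
    ∑ s', mmahhTrans (Jump n m) p q s s' *
      ENNReal.ofReal (pot n m q B K φ τ (zeros s'.1) s'.2) + 1 ≤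
      ENNReal.ofReal (pot n m q B K φ τ (zeros s.1) s.2) := by
  rw [sum_trans]
  have hp := h.hp; have hp1 := h.hp1; have hq := h.hq; have hq1 := h.hq1
  have hnn : ∀ (x : Point n) (o : Op), 0 ≤ pot n m q B K φ τ (zeros x) o :=
    fun x o => h.pot_nonneg (zeros_le x) o
  have hmix : ∀ (x : Point n) (o : Op), 0 ≤ mixPot n m p q B K φ τ o (zeros x) := by
    intro x o
    have h1 := hnn x Op.OI
    have h2 := hnn x Op.AM
    cases o
    · exact add_nonneg (mul_nonneg (by linarith) h1) (mul_nonneg (by linarith) h2)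
    · exact add_nonneg (mul_nonneg (by linarith) h1) (mul_nonneg (by linarith) h2)
  have e : ∀ (o : Op) (x : Point n), ∑ o', switchProb p q o o' *
      ENNReal.ofReal (pot n m q B K φ τ (zeros x) o') =
      ENNReal.ofReal (mixPot n m p q B K φ τ o (zeros x)) := by
    intro o x
    have h1 := hnn x Op.OI
    have h2 := hnn x Op.AM
    rw [sum_Op]
    cases o
    · simp only [switchProb, mixPot]
      rw [ENNReal.ofReal_add (mul_nonneg (by linarith) h1) (mul_nonneg (by linarith) h2),
        ENNReal.ofReal_mul (by linarith), ENNReal.ofReal_mul (by linarith)]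
    · simp only [switchProb, mixPot]
      rw [ENNReal.ofReal_add (mul_nonneg (by linarith) h1) (mul_nonneg (by linarith) h2),
        ENNReal.ofReal_mul (by linarith), ENNReal.ofReal_mul (by linarith)]
  simp_rw [e]
  rw [← ENNReal.ofReal_sum_of_nonneg fun v _ => hmix _ _, ← ENNReal.ofReal_natCast,
    ← ENNReal.ofReal_div_of_pos h.nR, ← ENNReal.ofReal_one, ← ENNReal.ofReal_add]
  · exact ENNReal.ofReal_le_ofReal (h.sum_le s.1 hs s.2)
  · exact div_nonneg (Finset.sum_nonneg fun v _ => hmix _ _) h.nR.le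
  · exact zero_le_one

lemma Good.pot_OI_bound (h : Good n m p q B K φ τ) {y : ℕ} (hy : y ≤ n) :
    pot n m q B K φ τ y Op.OI ≤ B + K * n * n := by
  have hB := h.B0
  have hn := h.nR
  have hK := h.K1
  have hKn : 0 ≤ K * n * n := by positivity
  have hyR : (y : ℝ) ≤ n := by exact_mod_cast hy
  rcases Nat.eq_zero_or_pos y with rfl | hy0
  · rw [pot_zero]; positivity
  rcases le_or_gt y m with hym | hym
  · rcases (show 1 ≤ y from hy0).eq_or_lt with rfl | hy2
    · rw [h.pot_one_OI]
      have : 0 ≤ B * (1 / n) := by positivity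
      linarith
    · rw [pot_OI_le hy2 hym]; linarith
  · rw [pot_OI_gt hym]
    have : K * n * (y - m) ≤ K * n * n :=
      mul_le_mul_of_nonneg_left (by linarith [h.mR]) (by positivity)
    linarith

end
/-- Numerical estimate of the constants. -/
lemma Good.final {n m : ℕ} {p q B K φ τ : ℝ} (h : Good n m p q B K φ τ) :
    B + K * n * n ≤ 10 * (1 + p * (n : ℝ)) * (1 / p + 1 / q) *
      ((n : ℝ) + (n : ℝ) ^ m / (((m - 1).factorial : ℝ) * (1 - q) ^ (m - 2))) := by
  have hn := h.nR
  have hp := h.hp; have hp1 := h.hp1; have hq := h.hq; have hq1 := h.hq1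
  have hm := h.mR
  have hmn := h.mn
  have hsg := sg_pos h.npos h.hq1 m
  set Q : ℝ := (1 + p * (n : ℝ)) * (1 / p + 1 / q) with hQ
  have hQe : Q = 1 / p + 1 / q + n + p * n / q := by
    rw [hQ]; field_simp
    try ring
  have ip : 1 ≤ 1 / p := by rw [le_div_iff₀ hp]; linarith
  have iq : 0 < 1 / q := by positivity
  have ipq : 0 ≤ p * n / q := by positivity
  have hQ0 : 0 ≤ Q := by rw [hQe]; positivity
  have hKn : K * n ≤ Q := by
    rw [h.hK, hQe, show (1 + p / q) * (n : ℝ) = n + p * n / q by ring]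
    linarith
  have hmQ : Q ≤ m * Q := by nlinarith
  have hφm : φ * (n - 2 * m) ≤ m / p := by
    rw [le_div_iff₀ hp]
    linarith [h.hφm]
  have hKφ : K * φ * (n - 2 * m) ≤ m * Q := by
    have h1 : K * (φ * (n - 2 * m)) ≤ K * (m / p) :=
      mul_le_mul_of_nonneg_left hφm (by linarith [h.K1])
    have h2 : K * (m / p) = m * (1 / p + 1 / q) := by
      rw [h.hK]; field_simp
      try ring
    have h3 : (m : ℝ) * (1 / p + 1 / q) ≤ m * Q := by
      apply mul_le_mul_of_nonneg_left _ (by linarith)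
      rw [hQe]; linarith
    linarith
  have hτ : τ + 2 / p ≤ 10 * (m * Q) := by
    have e2 : 2 / p = 2 * (1 / p) := by ring
    have : 1 / p + 1 / q ≤ Q := by rw [hQe]; linarith
    rw [h.hτ, e2]
    linarith
  have hsge : (m : ℝ) / sg n q m =
      (n : ℝ) ^ m / (((m - 1).factorial : ℝ) * (1 - q) ^ (m - 2)) := by
    have hf : (m.factorial : ℝ) = m * ((m - 1).factorial : ℝ) := by
      have := h.hm
      exact_mod_cast (Nat.mul_factorial_pred (by omega : m ≠ 0)).symm
    have : 0 < 1 - q := by linarith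
    have hm0 : (m : ℝ) ≠ 0 := by linarith
    have hf0 : ((m - 1).factorial : ℝ) ≠ 0 := by positivity
    have hn0 : (n : ℝ) ^ m ≠ 0 := by positivity
    have hq0 : (1 - q) ^ (m - 2) ≠ 0 := by positivity
    unfold sg
    rw [hf]
    field_simp
  rw [← hsge]
  have hB : B ≤ 10 * Q * (m / sg n q m) := by
    rw [show 10 * Q * (m / sg n q m) = 10 * (m * Q) / sg n q m by ring, le_div_iff₀ hsg, h.hB]
    exact hτ
  have h3 : K * n * n ≤ 10 * Q * n := by
    apply mul_le_mul_of_nonneg_right _ hn.le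
    linarith
  rw [show 10 * (1 + p * (n : ℝ)) * (1 / p + 1 / q) = 10 * Q by rw [hQ]; ring]
  linarith

lemma exists_good {n m : ℕ} {p q : ℝ} (hn3 : 3 ≤ n) (hm : 1 < m) (hmn : 2 * m < n)
    (hp : 0 < p) (hp1 : p < 1) (hq : 0 < q) (hq1 : q < 1)
    (hpq : p ≤ ((m : ℝ) / (2 * ((n : ℝ) - 2 * (m : ℝ)))) * (q + 4 / (n : ℝ))) :
    ∃ B K φ τ : ℝ, Good n m p q B K φ τ := by
  have hn : (5 : ℝ) ≤ n := by exact_mod_cast (by omega : 5 ≤ n)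
  have hmR : (2 : ℝ) ≤ m := by exact_mod_cast hm
  have hmnR : (2 * m + 1 : ℝ) ≤ n := by exact_mod_cast hmn
  have hsg := sg_pos (q := q) (by omega : 0 < n) hq1 m
  have hq1' : 0 < 1 - q := by linarith
  have hn0 : (0 : ℝ) < n := by linarith
  have hd : 0 < q + 2 * (1 - q) / n := by positivity
  have hd0 : 0 < (n : ℝ) - 2 * m := by linarith
  refine ⟨_, _, 1 / (q + 2 * (1 - q) / n), _,
    ⟨hm, hmn, hp, hp1, hq, hq1, by positivity, ?_, ?_, ?_, rfl, rfl,
      div_mul_cancel₀ _ hsg.ne'⟩⟩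
  · rw [div_le_iff₀ hd]
    have : (n : ℝ) / 2 * (q + 2 * (1 - q) / n) = n * q / 2 + (1 - q) := by field_simp
    rw [this]
    nlinarith
  · field_simp
  · have h1 : p * (n - 2 * m) ≤ m / 2 * (q + 4 / n) := by
      have := mul_le_mul_of_nonneg_right hpq hd0.le
      have e : (m : ℝ) / (2 * ((n : ℝ) - 2 * (m : ℝ))) * (q + 4 / (n : ℝ)) * (n - 2 * m) =
        m / 2 * (q + 4 / n) := by
        have hne : (n : ℝ) - 2 * m ≠ 0 := hd0.ne'
        generalize (n : ℝ) - 2 * m = d at hne ⊢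
        field_simp
      linarith
    have h2 : q + 4 / n ≤ 2 * (q + 2 * (1 - q) / n) := by
      have : (4 : ℝ) / n ≤ 1 := by rw [div_le_one hn0]; linarith
      have e : 2 * (q + 2 * (1 - q) / n) = 2 * q + 4 / n - q * (4 / n) := by ring
      rw [e]
      nlinarith
    have h3 : (m : ℝ) / 2 * (q + 4 / n) ≤ m / 2 * (2 * (q + 2 * (1 - q) / n)) :=
      mul_le_mul_of_nonneg_left h2 (by linarith)
    rw [show p * (1 / (q + 2 * (1 - q) / n)) * ((n : ℝ) - 2 * m) =
      (p * (n - 2 * m)) / (q + 2 * (1 - q) / n) by ring, div_le_iff₀ hd]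
    linarith

/-- Runtime of the MMAHH with OI+AM on `Jump_m`: general bound (Theorem 5 of the paper). -/
theorem mmahh_oi_am_jump :
    ∃ C : ℝ, 0 < C ∧
      ∀ (n m : ℕ) (p q : ℝ), 3 ≤ n → 1 < m → 2 * m < n →
        0 < p → p < 1 → 0 < q → q < 1 →
        p ≤ ((m : ℝ) / (2 * ((n : ℝ) - 2 * (m : ℝ)))) * (q + 4 / (n : ℝ)) →
        ∀ (Ω : Type) [MeasurableSpace Ω] (μ : Measure Ω) (X : ℕ → Ω → Point n × Op),
          IsProbabilityMeasure μ →
          IsMMAHH μ X (Jump n m) p q →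
          (∀ x0 : Point n, μ {ω | X 0 ω = (x0, Op.OI)} = 1 / 2 ^ n) →
          ∫⁻ ω, (hitTime X ω : ℝ≥0∞) ∂μ ≤
            ENNReal.ofReal (C * (1 + p * (n : ℝ)) * (1 / p + 1 / q) *
              ((n : ℝ) + (n : ℝ) ^ m / (((m - 1).factorial : ℝ) * (1 - q) ^ (m - 2)))) := by
  refine ⟨10, by norm_num, ?_⟩
  intro n m p q hn3 hm hmn hp hp1 hq hq1 hpq Ω _ μ X hμ hX h0
  obtain ⟨B, K, φ, τ, h⟩ := exists_good hn3 hm hmn hp hp1 hq hq1 hpq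
  refine (drift_bound μ X (Jump n m) p q hX
    (fun s => ENNReal.ofReal (pot n m q B K φ τ (zeros s.1) s.2)) h.super).trans ?_
  have hone : ∑ x0 : Point n, μ {ω | X 0 ω = (x0, Op.OI)} = 1 := by
    simp_rw [h0]
    rw [Finset.sum_const, nsmul_eq_mul, Finset.card_univ]
    simp only [Fintype.card_fun, Fintype.card_bool, Fintype.card_fin, Nat.cast_pow,
      Nat.cast_ofNat, one_div]
    exact ENNReal.mul_inv_cancel (by simp) (by simp)
  have hall : ∑ s : Point n × Op, μ {ω | X 0 ω = s} = 1 := by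
    have := sum_measure_preimage_singleton (μ := μ) (f := X 0) Finset.univ
      fun y _ => hX.1 0 (measurableSet_singleton y)
    simp only [Finset.coe_univ, Set.preimage_univ, measure_univ] at this
    exact this
  have hAM : ∑ x0 : Point n, μ {ω | X 0 ω = (x0, Op.AM)} = 0 := by
    rw [Fintype.sum_prod_type_right, sum_Op, hone] at hall
    exact (ENNReal.add_right_inj ENNReal.one_ne_top).1 (by rw [hall, add_zero])
  have hAM0 : ∀ x0 : Point n, μ {ω | X 0 ω = (x0, Op.AM)} = 0 := fun x0 =>
    (Finset.sum_eq_zero_iff.1 hAM) x0 (Finset.mem_univ _)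
  rw [Fintype.sum_prod_type_right, sum_Op]
  simp only [hAM0, zero_mul, Finset.sum_const_zero, add_zero]
  calc ∑ x : Point n, μ {ω | X 0 ω = (x, Op.OI)} *
        ENNReal.ofReal (pot n m q B K φ τ (zeros x) Op.OI)
      ≤ ∑ x : Point n, μ {ω | X 0 ω = (x, Op.OI)} * ENNReal.ofReal (B + K * n * n) := by
        refine Finset.sum_le_sum fun x _ => ?_
        gcongr
        exact h.pot_OI_bound (zeros_le x)
    _ = ENNReal.ofReal (B + K * n * n) := by rw [← Finset.sum_mul, hone, one_mul]
    _ ≤ _ := ENNReal.ofReal_le_ofReal h.final
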